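/- Assume λ1² + λ4² ≠ λ2² + λ3², and let α2 be the larger of the two real roots of f̃. If u, v ∈ ℝ satisfy α2·v² < u² < v², then the point e = (u, 0, 0, v, 0, 0) is an equilibrium of the so(4) free rigid body system and is Lyapunov stable. -/

import Mathlib

noncomputable section

/-- The right-hand side of the so(4) free rigid body system on ℝ⁶,
coordinates `(x1,x2,x3,y1,y2,y3) = (p 0, p 1, p 2, p 3, p 4, p 5)`. -/
def vf (l1 l2 l3 l4 : ℝ) (p : Fin 6 → ℝ) : Fin 6 → ℝ :=
  ![(1/(l1+l2) - 1/(l1+l3)) * (p 1 * p 2) + (1/(l3+l4) - 1/(l2+l4)) * (p 4 * p 5),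
    (1/(l2+l3) - 1/(l1+l2)) * (p 0 * p 2) + (1/(l1+l4) - 1/(l3+l4)) * (p 3 * p 5),
    (1/(l1+l3) - 1/(l2+l3)) * (p 0 * p 1) + (1/(l2+l4) - 1/(l1+l4)) * (p 3 * p 4),
    (1/(l3+l4) - 1/(l1+l3)) * (p 1 * p 5) + (1/(l1+l2) - 1/(l2+l4)) * (p 2 * p 4),
    (1/(l2+l3) - 1/(l3+l4)) * (p 0 * p 5) + (1/(l1+l4) - 1/(l1+l2)) * (p 2 * p 3),
    (1/(l2+l4) - 1/(l2+l3)) * (p 0 * p 4) + (1/(l1+l3) - 1/(l1+l4)) * (p 1 * p 3)]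

/-- Lyapunov stability of an equilibrium `e` of the so(4) free rigid body system:
for every ε > 0 there is δ > 0 such that every differentiable solution starting
δ-close to `e` stays ε-close to `e` for all t ≥ 0. -/
def IsLyapunovStable (l1 l2 l3 l4 : ℝ) (e : Fin 6 → ℝ) : Prop :=
  ∀ ε > 0, ∃ δ > 0, ∀ f : ℝ → (Fin 6 → ℝ),
    (∀ t : ℝ, HasDerivAt f (vf l1 l2 l3 l4 (f t)) t) →
    ‖f 0 - e‖ < δ → ∀ t ≥ 0, ‖f t - e‖ < ε

/-- The squared norm, a Casimir function of the system. -/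
def normSqCasimir (p : Fin 6 → ℝ) : ℝ :=
  p 0 ^ 2 + p 1 ^ 2 + p 2 ^ 2 + p 3 ^ 2 + p 4 ^ 2 + p 5 ^ 2

/-- The Pfaffian, a Casimir function of the system. -/
def pfaffian (p : Fin 6 → ℝ) : ℝ :=
  p 0 * p 3 + p 1 * p 4 + p 2 * p 5

/-- Manakov's pencil of quadratic first integrals, with `a, b, c, d` the squares of the `λi`. -/
def manakov (a b c d t : ℝ) (p : Fin 6 → ℝ) : ℝ :=
  (t - a) * (t - d) * p 0 ^ 2 + (t - b) * (t - d) * p 1 ^ 2 + (t - c) * (t - d) * p 2 ^ 2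
    + (t - b) * (t - c) * p 3 ^ 2 + (t - a) * (t - c) * p 4 ^ 2 + (t - a) * (t - b) * p 5 ^ 2

/-- A function along a solution is constant as soon as its derivative along the flow vanishes. -/
lemma eq_of_hasDerivAt_zero {g : ℝ → ℝ} (h : ∀ t, HasDerivAt g 0 t) (s t : ℝ) : g s = g t :=
  is_const_of_deriv_eq_zero (fun t => (h t).differentiableAt) (fun t => (h t).deriv) s t

section Conservation

variable {l1 l2 l3 l4 : ℝ} {f : ℝ → (Fin 6 → ℝ)}

lemma normSqCasimir_conserved (hf : ∀ t, HasDerivAt f (vf l1 l2 l3 l4 (f t)) t) (s t : ℝ) :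
    normSqCasimir (f s) = normSqCasimir (f t) := by
  refine eq_of_hasDerivAt_zero (g := fun t => normSqCasimir (f t)) (fun t => ?_) s t
  have h := hasDerivAt_pi.1 (hf t)
  refine HasDerivAt.congr_deriv
    (((((((h 0).pow 2).add ((h 1).pow 2)).add ((h 2).pow 2)).add ((h 3).pow 2)).add
    ((h 4).pow 2)).add ((h 5).pow 2)) ?_
  simp [vf]
  ring

lemma pfaffian_conserved (hf : ∀ t, HasDerivAt f (vf l1 l2 l3 l4 (f t)) t) (s t : ℝ) :
    pfaffian (f s) = pfaffian (f t) := by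
  refine eq_of_hasDerivAt_zero (g := fun t => pfaffian (f t)) (fun t => ?_) s t
  have h := hasDerivAt_pi.1 (hf t)
  refine HasDerivAt.congr_deriv
    ((((h 0).mul (h 3)).add ((h 1).mul (h 4))).add ((h 2).mul (h 5))) ?_
  simp [vf]
  ring

lemma manakov_conserved (s12 : l1 + l2 ≠ 0) (s13 : l1 + l3 ≠ 0) (s14 : l1 + l4 ≠ 0)
    (s23 : l2 + l3 ≠ 0) (s24 : l2 + l4 ≠ 0) (s34 : l3 + l4 ≠ 0) (τ : ℝ)
    (hf : ∀ t, HasDerivAt f (vf l1 l2 l3 l4 (f t)) t) (s t : ℝ) :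
    manakov (l1 ^ 2) (l2 ^ 2) (l3 ^ 2) (l4 ^ 2) τ (f s)
      = manakov (l1 ^ 2) (l2 ^ 2) (l3 ^ 2) (l4 ^ 2) τ (f t) := by
  refine eq_of_hasDerivAt_zero
    (g := fun t => manakov (l1 ^ 2) (l2 ^ 2) (l3 ^ 2) (l4 ^ 2) τ (f t)) (fun t => ?_) s t
  have h := hasDerivAt_pi.1 (hf t)
  refine HasDerivAt.congr_deriv
    ((((((((h 0).pow 2).const_mul _).add (((h 1).pow 2).const_mul _)).add
    (((h 2).pow 2).const_mul _)).add (((h 3).pow 2).const_mul _)).add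
    (((h 4).pow 2).const_mul _)).add (((h 5).pow 2).const_mul _)) ?_
  simp [vf]
  field_simp
  ring

end Conservation

/-- Lyapunov's criterion for a conserved function that vanishes at `e` and is positive on all
small spheres around `e`. -/
lemma isLyapunovStable_of_conserved {l1 l2 l3 l4 : ℝ} {e : Fin 6 → ℝ} {V : (Fin 6 → ℝ) → ℝ}
    (hV : Continuous V) (hVe : V e = 0) {R : ℝ} (hR : 0 < R)
    (hpos : ∀ p, 0 < ‖p - e‖ → ‖p - e‖ < R → 0 < V p)
    (hcons : ∀ f : ℝ → (Fin 6 → ℝ), (∀ t, HasDerivAt f (vf l1 l2 l3 l4 (f t)) t) →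
      ∀ t, V (f t) = V (f 0)) :
    IsLyapunovStable l1 l2 l3 l4 e := by
  intro ε hε
  obtain ⟨ρ, hρ, hρ'⟩ := exists_between (lt_min hε hR)
  have hρε : ρ < ε := hρ'.trans_le (min_le_left _ _)
  have hρR : ρ < R := hρ'.trans_le (min_le_right _ _)
  obtain ⟨q, hq, hqmin⟩ := (isCompact_sphere e ρ).exists_isMinOn
    (NormedSpace.sphere_nonempty.2 hρ.le) hV.continuousOn
  have hq' : ‖q - e‖ = ρ := mem_sphere_iff_norm.1 hq
  have hVq : 0 < V q := hpos q (hq' ▸ hρ) (hq' ▸ hρR)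
  obtain ⟨δ, hδ, hδV⟩ := Metric.mem_nhds_iff.1
    (hV.continuousAt.eventually_lt (continuousAt_const (y := V q)) (by rwa [hVe]))
  refine ⟨min δ ρ, lt_min hδ hρ, fun f hf h0 t ht => ?_⟩
  by_contra! hlt
  have hcont : Continuous fun s => ‖f s - e‖ :=
    ((continuous_iff_continuousAt.2 fun s => (hf s).continuousAt).sub continuous_const).norm
  obtain ⟨s, -, hs⟩ := intermediate_value_Icc ht hcont.continuousOn
    ⟨(h0.trans_le (min_le_right _ _)).le, hρε.le.trans hlt⟩
  have h1 : V q ≤ V (f s) := hqmin (mem_sphere_iff_norm.2 hs)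
  have h2 : V (f 0) < V q := hδV (mem_ball_iff_norm.2 (h0.trans_le (min_le_left _ _)))
  rw [hcons f hf s] at h1
  exact h1.not_gt h2

lemma binary_form_nonneg {A B ν : ℝ} (hA : 0 < A) (hD : ν ^ 2 < 4 * (A * B)) (x y : ℝ) :
    0 ≤ A * x ^ 2 + B * y ^ 2 + ν * (x * y) := by
  have h : 4 * A * (A * x ^ 2 + B * y ^ 2 + ν * (x * y))
      = (2 * A * x + ν * y) ^ 2 + (4 * (A * B) - ν ^ 2) * y ^ 2 := by ring
  have h' : 0 ≤ (4 * (A * B) - ν ^ 2) * y ^ 2 := mul_nonneg (by linarith) (sq_nonneg y)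
  exact nonneg_of_mul_nonneg_right (h ▸ by positivity) (by positivity : 0 < 4 * A)

lemma binary_form_eq_zero {A B ν : ℝ} (hA : 0 < A) (hD : ν ^ 2 < 4 * (A * B)) {x y : ℝ}
    (h0 : A * x ^ 2 + B * y ^ 2 + ν * (x * y) = 0) : x = 0 ∧ y = 0 := by
  have h : (2 * A * x + ν * y) ^ 2 + (4 * (A * B) - ν ^ 2) * y ^ 2 = 0 := by
    linear_combination 4 * A * h0
  have hy : y = 0 := by
    by_contra hy
    have : 0 < (4 * (A * B) - ν ^ 2) * y ^ 2 := mul_pos (by linarith) (by positivity)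
    nlinarith [sq_nonneg (2 * A * x + ν * y)]
  subst hy
  exact ⟨by simpa [hA.ne'] using h0, rfl⟩

/-- The member of Manakov's pencil, shifted by the Casimir function `μ ‖·‖²`, that can be made
critical at an equilibrium with `u² = r v²`. -/
lemma exists_pencil_parameter {a b c d α1 α2 r : ℝ} (hab : b < a) (hbc : c < b) (hcd : d < c)
    (hα : α1 < α2)
    (hr1 : (a - d) ^ 2 * α1 ^ 2 - 2 * ((a - b) * (c - d) + (a - c) * (b - d)) * α1
      + (b - c) ^ 2 = 0)
    (hr2 : (a - d) ^ 2 * α2 ^ 2 - 2 * ((a - b) * (c - d) + (a - c) * (b - d)) * α2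
      + (b - c) ^ 2 = 0)
    (hr : α2 < r) (hr' : r < 1) :
    ∃ t μ : ℝ, 0 < μ ∧ (a < t ∨ t < d) ∧
      (t - b) * (t - c) + μ = r * ((t - a) * (t - d) + μ) := by
  have hr1' : 0 < 1 - r := by linarith
  have hvieta : (a - d) ^ 2 * (α1 + α2) = 2 * ((a - b) * (c - d) + (a - c) * (b - d)) :=
    mul_left_cancel₀ (sub_ne_zero.2 hα.ne') (by linear_combination hr2 - hr1)
  have hdisc : 0 < (a - d) ^ 2 * ((r - α1) * (r - α2)) :=
    mul_pos (pow_pos (by linarith) 2) (mul_pos (by linarith) (by linarith))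
  obtain ⟨t, ht⟩ : ∃ t, 2 * (1 - r) * t = b + c - r * (a + d) :=
    ⟨(b + c - r * (a + d)) / (2 * (1 - r)), by field_simp⟩
  have hq : 0 < r * ((t - a) * (t - d)) - (t - b) * (t - c) := by
    refine pos_of_mul_pos_right (a := 4 * (1 - r)) (hdisc.trans_eq ?_) (by linarith)
    linear_combination -hr1 + (α1 - r) * hvieta
      + (2 * (1 - r) * t - (b + c - r * (a + d))) * ht
  refine ⟨t, (r * ((t - a) * (t - d)) - (t - b) * (t - c)) / (1 - r), div_pos hq hr1', ?_, ?_⟩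
  · by_contra! h
    have hin : (t - a) * (t - d) ≤ 0 :=
      mul_nonpos_of_nonpos_of_nonneg (by linarith) (by linarith)
    have hq1 : 0 < α1 * ((t - a) * (t - d)) - (t - b) * (t - c) := by nlinarith
    have := mul_pos (show 0 < 4 * (1 - α1) by linarith) hq1
    nlinarith [sq_nonneg (2 * (1 - α1) * t - (b + c - α1 * (a + d)))]
  · field_simp
    ring

/-- A quadratic first integral that is nonnegative and vanishes only on the line through the
equilibrium. -/
lemma exists_semidefinite_integral {a b c d α1 α2 u v : ℝ}
    (hab : b < a) (hbc : c < b) (hcd : d < c) (hα : α1 < α2)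
    (hr1 : (a - d) ^ 2 * α1 ^ 2 - 2 * ((a - b) * (c - d) + (a - c) * (b - d)) * α1
      + (b - c) ^ 2 = 0)
    (hr2 : (a - d) ^ 2 * α2 ^ 2 - 2 * ((a - b) * (c - d) + (a - c) * (b - d)) * α2
      + (b - c) ^ 2 = 0)
    (hlo : α2 * v ^ 2 < u ^ 2) (hhi : u ^ 2 < v ^ 2) :
    ∃ t μ ν : ℝ,
      (∀ p, 0 ≤ manakov a b c d t p + μ * normSqCasimir p + ν * pfaffian p) ∧
      ∀ p, manakov a b c d t p + μ * normSqCasimir p + ν * pfaffian p = 0 ↔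
        p 0 * v = u * p 3 ∧ p 1 = 0 ∧ p 2 = 0 ∧ p 4 = 0 ∧ p 5 = 0 := by
  have hv2 : 0 < v ^ 2 := (sq_nonneg u).trans_lt hhi
  have hv : v ≠ 0 := by rintro rfl; simp at hv2
  obtain ⟨k, rfl⟩ : ∃ k, u = k * v := ⟨u / v, by field_simp⟩
  rw [mul_pow] at hlo hhi
  obtain ⟨t, μ, hμ, ht, hcrit⟩ := exists_pencil_parameter (r := k ^ 2) hab hbc hcd hα hr1 hr2
    (lt_of_mul_lt_mul_right hlo hv2.le) (by nlinarith)
  have hpos : 0 < (t - a) * (t - d) ∧ 0 < (t - b) * (t - d) ∧ 0 < (t - c) * (t - d) := by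
    rcases ht with ht | ht
    · refine ⟨mul_pos ?_ ?_, mul_pos ?_ ?_, mul_pos ?_ ?_⟩ <;> linarith
    · refine ⟨mul_pos_of_neg_of_neg ?_ ?_, mul_pos_of_neg_of_neg ?_ ?_,
        mul_pos_of_neg_of_neg ?_ ?_⟩ <;> linarith
  obtain ⟨h1, h2, h3⟩ := hpos
  set A := (t - a) * (t - d) + μ with hA
  have hA0 : 0 < A := by linarith
  have hν : (-2 * A * k) ^ 2 = 4 * (((t - a) * (t - d) + μ) * ((t - b) * (t - c) + μ)) := by
    rw [hcrit]; ring
  have hD2 : (-2 * A * k) ^ 2 < 4 * (((t - b) * (t - d) + μ) * ((t - a) * (t - c) + μ)) := by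
    rw [hν]
    nlinarith [mul_pos hμ (mul_pos (sub_pos.2 hab) (sub_pos.2 hcd))]
  have hD3 : (-2 * A * k) ^ 2 < 4 * (((t - c) * (t - d) + μ) * ((t - a) * (t - b) + μ)) := by
    rw [hν]
    nlinarith [mul_pos hμ (mul_pos (sub_pos.2 (hbc.trans hab)) (sub_pos.2 (hcd.trans hbc)))]
  have hB2 : 0 < (t - b) * (t - d) + μ := by linarith
  have hB3 : 0 < (t - c) * (t - d) + μ := by linarith
  have key : ∀ p : Fin 6 → ℝ,
      manakov a b c d t p + μ * normSqCasimir p + -2 * A * k * pfaffian p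
        = A * (p 0 - k * p 3) ^ 2
          + (((t - b) * (t - d) + μ) * p 1 ^ 2 + ((t - a) * (t - c) + μ) * p 4 ^ 2
            + -2 * A * k * (p 1 * p 4))
          + (((t - c) * (t - d) + μ) * p 2 ^ 2 + ((t - a) * (t - b) + μ) * p 5 ^ 2
            + -2 * A * k * (p 2 * p 5)) := by
    intro p
    simp only [manakov, normSqCasimir, pfaffian]
    linear_combination p 3 ^ 2 * hcrit - p 0 ^ 2 * hA
  refine ⟨t, μ, -2 * A * k, fun p => ?_, fun p => ?_⟩ <;> rw [key p]
  · have := binary_form_nonneg hB2 hD2 (p 1) (p 4)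
    have := binary_form_nonneg hB3 hD3 (p 2) (p 5)
    positivity
  · constructor
    · intro h0
      have n1 : 0 ≤ A * (p 0 - k * p 3) ^ 2 := by positivity
      have n2 := binary_form_nonneg hB2 hD2 (p 1) (p 4)
      have n3 := binary_form_nonneg hB3 hD3 (p 2) (p 5)
      obtain ⟨e1, e4⟩ := binary_form_eq_zero hB2 hD2 (x := p 1) (y := p 4) (by linarith)
      obtain ⟨e2, e5⟩ := binary_form_eq_zero hB3 hD3 (x := p 2) (y := p 5) (by linarith)
      have e0 : A * (p 0 - k * p 3) ^ 2 = 0 := by linarith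
      have e0' : p 0 - k * p 3 = 0 := by simpa [hA0.ne'] using e0
      exact ⟨by linear_combination v * e0', e1, e2, e4, e5⟩
    · rintro ⟨e0, e1, e2, e4, e5⟩
      have e0' : p 0 - k * p 3 = 0 :=
        mul_right_cancel₀ hv (by linear_combination e0)
      simp [e0', e1, e2, e4, e5]

/-- for `α2 v² < u² < v²` (α2 the larger root of f̃, assuming
`λ1² + λ4² ≠ λ2² + λ3²`) the equilibrium `(u,0,0,v,0,0)` is Lyapunov stable. -/
theorem t1_bifurcation_equilibria_stable
    (l1 l2 l3 l4 : ℝ) (h12 : l2 < l1) (h23 : l3 < l2) (h34 : l4 < l3)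
    (s12 : 0 < l1 + l2) (s13 : 0 < l1 + l3) (s14 : 0 < l1 + l4)
    (s23 : 0 < l2 + l3) (s24 : 0 < l2 + l4) (s34 : 0 < l3 + l4)
    (hne : l1 ^ 2 + l4 ^ 2 ≠ l2 ^ 2 + l3 ^ 2)
    (α1 α2 : ℝ) (hα : α1 < α2)
    (hr1 : (l1^2 - l4^2)^2 * α1 ^ 2
        - 2 * ((l1^2 - l2^2) * (l3^2 - l4^2) + (l1^2 - l3^2) * (l2^2 - l4^2)) * α1
        + (l2^2 - l3^2)^2 = 0)
    (hr2 : (l1^2 - l4^2)^2 * α2 ^ 2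
        - 2 * ((l1^2 - l2^2) * (l3^2 - l4^2) + (l1^2 - l3^2) * (l2^2 - l4^2)) * α2
        + (l2^2 - l3^2)^2 = 0)
    (u v : ℝ) (hlo : α2 * v ^ 2 < u ^ 2) (hhi : u ^ 2 < v ^ 2) :
    vf l1 l2 l3 l4 ![u, 0, 0, v, 0, 0] = 0 ∧
      IsLyapunovStable l1 l2 l3 l4 ![u, 0, 0, v, 0, 0] := by
  refine ⟨by ext i; fin_cases i <;> simp [vf], ?_⟩
  have hv2 : 0 < v ^ 2 := (sq_nonneg u).trans_lt hhi
  have hv : v ≠ 0 := by rintro rfl; simp at hv2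
  obtain ⟨t, μ, ν, hnn, hzero⟩ := exists_semidefinite_integral
    (a := l1 ^ 2) (b := l2 ^ 2) (c := l3 ^ 2) (d := l4 ^ 2)
    (by nlinarith) (by nlinarith) (by nlinarith) hα hr1 hr2 hlo hhi
  set e : Fin 6 → ℝ := ![u, 0, 0, v, 0, 0] with he
  set Q : (Fin 6 → ℝ) → ℝ := fun p =>
    manakov (l1 ^ 2) (l2 ^ 2) (l3 ^ 2) (l4 ^ 2) t p + μ * normSqCasimir p + ν * pfaffian p with hQ
  have hQe : Q e = 0 := (hzero e).2 (by simp [he])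
  refine isLyapunovStable_of_conserved
    (V := fun p => Q p + (normSqCasimir p - normSqCasimir e) ^ 2) ?_ (by simp [hQe])
    (abs_pos.2 hv) (fun p hp hpR => ?_) (fun f hf s => ?_)
  · simp only [hQ, manakov, normSqCasimir, pfaffian]
    fun_prop
  · refine lt_of_le_of_ne (add_nonneg (hnn p) (sq_nonneg _)) fun h0 => ?_
    have hQ0 : Q p = 0 := by
      linarith [hnn p, sq_nonneg (normSqCasimir p - normSqCasimir e)]
    have hC0 : normSqCasimir p - normSqCasimir e = 0 :=
      pow_eq_zero_iff two_ne_zero |>.1 (by linarith)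
    obtain ⟨e0, e1, e2, e4, e5⟩ := (hzero p).1 hQ0
    have hC : p 0 ^ 2 + p 3 ^ 2 = u ^ 2 + v ^ 2 := by
      simp [normSqCasimir, he, e1, e2, e4, e5] at hC0
      linarith
    have h3 : p 3 ^ 2 = v ^ 2 := by
      refine mul_left_cancel₀ (by positivity : u ^ 2 + v ^ 2 ≠ 0) ?_
      linear_combination v ^ 2 * hC - (p 0 * v + u * p 3) * e0
    rcases sq_eq_sq_iff_eq_or_eq_neg.1 h3 with h3 | h3
    · have h0' : p 0 = u := mul_right_cancel₀ hv (by rw [e0, h3])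
      have : p = e := by ext i; fin_cases i <;> simp [he, h0', h3, e1, e2, e4, e5]
      simp [this] at hp
    · have := (norm_le_pi_norm (p - e) 3).trans_lt hpR
      have h2 : (p - e) 3 = -(2 * v) := by simp [he, h3]; ring
      rw [h2, norm_neg, norm_mul, Real.norm_eq_abs, Real.norm_eq_abs, abs_two] at this
      linarith [abs_nonneg v]
  · simp only [hQ]
    rw [manakov_conserved s12.ne' s13.ne' s14.ne' s23.ne' s24.ne' s34.ne' t hf s 0,
      normSqCasimir_conserved hf s 0, pfaffian_conserved hf s 0]
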